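/- arXiv:1101.0172 — 6 statements merged into one kernel-verified Lean document; each statement's English description precedes it below -/
import Mathlib

section
/- Let u be a locally bounded real-valued function on [0,T]×ℝᵈ. Then the function M u_* (the intervention operator applied to the lower semicontinuous envelope of u) is lower semicontinuous on [0,T]×ℝᵈ, and M u_* ≤ (M u)_* pointwise on [0,T]×ℝᵈ. -/
open Filter Topology Metric Set

noncomputable section

abbrev Euc (n : ℕ) : Type := EuclideanSpace ℝ (Fin n)

/-- Lower semicontinuous envelope of `u`, taken within the set `D`. -/
noncomputable def lscEnv {α : Type*} [TopologicalSpace α] (D : Set α) (u : α → ℝ) (y : α) : ℝ :=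
  Filter.liminf u (nhdsWithin y D)

/-- Upper semicontinuous envelope of `u`, taken within the set `D`. -/
noncomputable def uscEnv {α : Type*} [TopologicalSpace α] (D : Set α) (u : α → ℝ) (y : α) : ℝ :=
  Filter.limsup u (nhdsWithin y D)

/-- The intervention operator
`M u (t,x) = sup { u (t, Γ(t,x,ζ)) + K(t,x,ζ) : ζ ∈ Z(t,x) }`. -/
noncomputable def Mop {d : ℕ} (Γ : (ℝ × Euc d) → Euc d → Euc d)
    (K : (ℝ × Euc d) → Euc d → ℝ) (Z : (ℝ × Euc d) → Set (Euc d))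
    (u : ℝ × Euc d → ℝ) (y : ℝ × Euc d) : ℝ :=
  sSup ((fun ζ => u (y.1, Γ y ζ) + K y ζ) '' Z y)

/-- The real-valued lower envelope lies below the function wherever the latter is locally bounded
below. -/
lemma lscEnv_le {α : Type*} [TopologicalSpace α] {D : Set α} {u : α → ℝ} {y : α} (hy : y ∈ D)
    (hb : IsBoundedUnder (· ≥ ·) (𝓝[D] y) u) : lscEnv D u y ≤ u y :=
  liminf_le_of_frequently_le
    (Frequently.filter_mono (f := pure y) (by simp) (pure_le_nhdsWithin hy)) hb

/-- An eventual lower bound passes to the lower envelope. -/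
lemma le_lscEnv {α : Type*} [TopologicalSpace α] {D : Set α} {u : α → ℝ} {y : α} {a : ℝ}
    (hy : y ∈ D) (h : ∀ᶠ z in 𝓝[D] y, a ≤ u z) : a ≤ lscEnv D u y := by
  refine le_liminf_of_le ?_ h
  exact IsCoboundedUnder.of_frequently_le (a := u y)
    (Frequently.filter_mono (f := pure y) (by simp) (pure_le_nhdsWithin hy))

lemma lowerSemicontinuousOn_lscEnv {α : Type*} [TopologicalSpace α] {D : Set α} {u : α → ℝ}
    (hb : ∀ y ∈ D, IsBoundedUnder (· ≥ ·) (𝓝[D] y) u) :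
    LowerSemicontinuousOn (lscEnv D u) D := by
  intro y hy a ha
  obtain ⟨b, hab, hb'⟩ := exists_between ha
  have h : ∀ᶠ z in 𝓝[D] y, b < u z := eventually_lt_of_lt_liminf hb' (hb y hy)
  filter_upwards [eventually_eventually_nhdsWithin.2 h, self_mem_nhdsWithin] with z hz hzD
  exact hab.trans_le (le_lscEnv hzD (hz.mono fun _ h => h.le))

/-- Sequential Hausdorff continuity of a set-valued map, as an eventual statement. -/
lemma eventually_hausdorffDist_lt {α β : Type*} [TopologicalSpace α] [FirstCountableTopology α]
    [PseudoMetricSpace β] {D : Set α} {Z : α → Set β} {y : α}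
    (hZ : ∀ p : ℕ → α, (∀ n, p n ∈ D) → Tendsto p atTop (𝓝 y) →
      Tendsto (fun n => hausdorffDist (Z (p n)) (Z y)) atTop (𝓝 0))
    {δ : ℝ} (hδ : 0 < δ) : ∀ᶠ z in 𝓝[D] y, hausdorffDist (Z z) (Z y) < δ := by
  by_contra h
  have h' : ∃ᶠ z in 𝓝[D] y, ¬ hausdorffDist (Z z) (Z y) < δ ∧ z ∈ D :=
    (not_eventually.1 h).and_eventually self_mem_nhdsWithin
  obtain ⟨p, hp, hpp⟩ := exists_seq_forall_of_frequently h'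
  obtain ⟨n, hn⟩ := ((hZ p (fun n => (hpp n).2) (hp.mono_right nhdsWithin_le_nhds)).eventually
    (gt_mem_nhds hδ)).exists
  exact (hpp n).1 hn

/-- A function locally bounded above on a compact set is bounded above on it. -/
lemma IsCompact.bddAbove_image_of_locally {β : Type*} [TopologicalSpace β] {s : Set β}
    (hs : IsCompact s) {g : β → ℝ} (hg : ∀ x ∈ s, ∃ C, ∀ᶠ z in 𝓝[s] x, g z ≤ C) :
    BddAbove (g '' s) := by
  refine hs.induction_on (p := fun t => BddAbove (g '' t)) (by simp)
    (fun _ _ hst ht => ht.mono (image_mono hst))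
    (fun _ _ h₁ h₂ => by rw [image_union]; exact h₁.union h₂) ?_
  intro x hx
  obtain ⟨C, hC⟩ := hg x hx
  exact ⟨_, hC, C, by rintro _ ⟨z, hz, rfl⟩; exact hz⟩

/-- The intervention operator preserves lower semicontinuity. -/
lemma lowerSemicontinuousOn_Mop {d : ℕ} {Γ : (ℝ × Euc d) → Euc d → Euc d}
    {K : (ℝ × Euc d) → Euc d → ℝ} {Z : (ℝ × Euc d) → Set (Euc d)} {D : Set (ℝ × Euc d)}
    {v : ℝ × Euc d → ℝ}
    (hΓ : ContinuousOn (fun p : (ℝ × Euc d) × Euc d => Γ p.1 p.2) (D ×ˢ univ))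
    (hK : ContinuousOn (fun p : (ℝ × Euc d) × Euc d => K p.1 p.2) (D ×ˢ univ))
    (hD : ∀ y ∈ D, ∀ ζ, (y.1, Γ y ζ) ∈ D)
    (hZne : ∀ y ∈ D, (Z y).Nonempty) (hZcp : ∀ y ∈ D, IsCompact (Z y))
    (hZ : ∀ y ∈ D, ∀ δ > 0, ∀ᶠ z in 𝓝[D] y, hausdorffDist (Z z) (Z y) < δ)
    (hv : LowerSemicontinuousOn v D)
    (hbdd : ∀ y ∈ D, BddAbove ((fun ζ => v (y.1, Γ y ζ) + K y ζ) '' Z y)) :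
    LowerSemicontinuousOn (Mop Γ K Z v) D := by
  intro y hy a ha
  obtain ⟨_, ⟨ζ, hζ, rfl⟩, haζ⟩ := exists_lt_of_lt_csSup ((hZne y hy).image _) ha
  have hmem : (y, ζ) ∈ D ×ˢ (univ : Set (Euc d)) := ⟨hy, mem_univ _⟩
  obtain ⟨b, hb₁, hb₂⟩ := exists_between (sub_lt_iff_lt_add.2 haζ)
  have htend : Tendsto (fun p : (ℝ × Euc d) × Euc d => (p.1.1, Γ p.1 p.2))
      (𝓝[D ×ˢ univ] (y, ζ)) (𝓝[D] (y.1, Γ y ζ)) := by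
    refine tendsto_nhdsWithin_iff.2 ⟨?_, ?_⟩
    · exact ((continuous_fst.comp continuous_fst).continuousWithinAt).prodMk (hΓ _ hmem)
    · filter_upwards [self_mem_nhdsWithin] with p hp using hD _ hp.1 _
  have hev : ∀ᶠ p in 𝓝[D ×ˢ univ] (y, ζ),
      a < v (p.1.1, Γ p.1 p.2) + K p.1 p.2 := by
    filter_upwards [htend.eventually (hv _ (hD y hy ζ) b hb₂),
      (hK _ hmem).eventually (lt_mem_nhds (sub_lt_comm.1 hb₁))] with p h₁ h₂
    linarith
  rw [nhdsWithin_prod_eq, nhdsWithin_univ] at hev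
  obtain ⟨P, hP, Q, hQ, hPQ⟩ := eventually_prod_iff.1 hev
  obtain ⟨δ, hδ, hball⟩ := Metric.eventually_nhds_iff.1 hQ
  filter_upwards [hP, hZ y hy δ hδ, self_mem_nhdsWithin] with z hz hzδ hzD
  obtain ⟨ξ, hξ, hdist⟩ := exists_dist_lt_of_hausdorffDist_lt' hζ hzδ
    (hausdorffEDist_ne_top_of_nonempty_of_bounded (hZne z hzD) (hZne y hy)
      (hZcp z hzD).isBounded (hZcp y hy).isBounded)
  exact (hPQ hz (hball hdist)).trans_le (le_csSup (hbdd z hzD) (mem_image_of_mem _ hξ))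

/-- For `u` locally bounded on `[0,T] × ℝᵈ`, the function `M u_*` is lower
semicontinuous on `[0,T] × ℝᵈ`, and `M u_* ≤ (M u)_*` pointwise on `[0,T] × ℝᵈ`. -/
theorem stmt0 {d : ℕ} (hd : 1 ≤ d) {T : ℝ} (hT : 0 < T)
    (Γ : (ℝ × Euc d) → Euc d → Euc d) (K : (ℝ × Euc d) → Euc d → ℝ)
    (Z : (ℝ × Euc d) → Set (Euc d))
    (D : Set (ℝ × Euc d)) (hD : D = Set.Icc (0:ℝ) T ×ˢ (Set.univ : Set (Euc d)))
    (hΓ : ContinuousOn (fun p : (ℝ × Euc d) × Euc d => Γ p.1 p.2) (D ×ˢ (Set.univ : Set (Euc d))))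
    (hK : ContinuousOn (fun p : (ℝ × Euc d) × Euc d => K p.1 p.2) (D ×ˢ (Set.univ : Set (Euc d))))
    (hZne : ∀ y ∈ D, (Z y).Nonempty)
    (hZcp : ∀ y ∈ D, IsCompact (Z y))
    (hZH : ∀ (p : ℕ → ℝ × Euc d) (q : ℝ × Euc d), (∀ n, p n ∈ D) → q ∈ D →
      Filter.Tendsto p Filter.atTop (𝓝 q) →
      Filter.Tendsto (fun n => Metric.hausdorffDist (Z (p n)) (Z q)) Filter.atTop (𝓝 (0:ℝ)))
    (u : ℝ × Euc d → ℝ)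
    (hu : ∀ y ∈ D, ∃ U ∈ 𝓝 y, ∃ C : ℝ, ∀ z ∈ U ∩ D, |u z| ≤ C) :
    LowerSemicontinuousOn (Mop Γ K Z (lscEnv D u)) D ∧
      ∀ y ∈ D, Mop Γ K Z (lscEnv D u) y ≤ lscEnv D (Mop Γ K Z u) y := by
  have hDΓ : ∀ y ∈ D, ∀ ζ, (y.1, Γ y ζ) ∈ D := by
    subst hD
    exact fun y hy ζ => ⟨hy.1, mem_univ _⟩
  have hbelow : ∀ y ∈ D, IsBoundedUnder (· ≥ ·) (𝓝[D] y) u := by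
    intro y hy
    obtain ⟨U, hU, C, hC⟩ := hu y hy
    refine isBoundedUnder_of_eventually_ge (a := -C) ?_
    filter_upwards [mem_nhdsWithin_of_mem_nhds hU, self_mem_nhdsWithin] with z hz hzD
    exact (abs_le.1 (hC z ⟨hz, hzD⟩)).1
  have hbdd : ∀ y ∈ D, BddAbove ((fun ζ => u (y.1, Γ y ζ) + K y ζ) '' Z y) := by
    intro y hy
    refine (hZcp y hy).bddAbove_image_of_locally fun ζ _ => ?_
    have hpair : Continuous fun ξ : Euc d => (y, ξ) := by fun_prop
    have hΓy : Continuous (Γ y) :=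
      hΓ.comp_continuous hpair fun ξ => ⟨hy, mem_univ _⟩
    have hKy : Continuous (K y) :=
      hK.comp_continuous hpair fun ξ => ⟨hy, mem_univ _⟩
    obtain ⟨U, hU, C, hC⟩ := hu _ (hDΓ y hy ζ)
    have hcont : Continuous fun ξ => (y.1, Γ y ξ) := by fun_prop
    refine ⟨C + (K y ζ + 1), Eventually.filter_mono nhdsWithin_le_nhds ?_⟩
    filter_upwards [hcont.continuousAt hU,
      hKy.continuousAt.eventually (gt_mem_nhds (lt_add_one (K y ζ)))] with ξ h₁ h₂
    exact add_le_add (abs_le.1 (hC _ ⟨h₁, hDΓ y hy ξ⟩)).2 h₂.le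
  have hle : ∀ y ∈ D, ∀ ζ, lscEnv D u (y.1, Γ y ζ) + K y ζ ≤ u (y.1, Γ y ζ) + K y ζ :=
    fun y hy ζ => by
      gcongr
      exact lscEnv_le (hDΓ y hy ζ) (hbelow _ (hDΓ y hy ζ))
  have hbdd' : ∀ y ∈ D, BddAbove ((fun ζ => lscEnv D u (y.1, Γ y ζ) + K y ζ) '' Z y) := by
    intro y hy
    obtain ⟨C, hC⟩ := hbdd y hy
    refine ⟨C, ?_⟩
    rintro _ ⟨ζ, hζ, rfl⟩
    exact (hle y hy ζ).trans (hC (mem_image_of_mem _ hζ))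
  have hlsc : LowerSemicontinuousOn (Mop Γ K Z (lscEnv D u)) D :=
    lowerSemicontinuousOn_Mop hΓ hK hDΓ hZne hZcp
      (fun y hy δ hδ => eventually_hausdorffDist_lt (fun p hp => hZH p y hp hy) hδ)
      (lowerSemicontinuousOn_lscEnv hbelow) hbdd'
  refine ⟨hlsc, fun y hy => le_of_forall_lt fun a ha => ?_⟩
  obtain ⟨b, hab, hb⟩ := exists_between ha
  refine hab.trans_le (le_lscEnv hy ?_)
  filter_upwards [hlsc y hy b hb, self_mem_nhdsWithin] with z hz hzD
  refine hz.le.trans (csSup_le ((hZne z hzD).image _) ?_)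
  rintro _ ⟨ζ, hζ, rfl⟩
  exact (hle z hzD ζ).trans (le_csSup (hbdd z hzD) (mem_image_of_mem _ hζ))
end
end

section
/- Let u be a locally bounded real-valued function on [0,T]×ℝᵈ. Then the function M u* (the intervention operator applied to the upper semicontinuous envelope of u) is upper semicontinuous on [0,T]×ℝᵈ, and (M u)* ≤ M u* pointwise on [0,T]×ℝᵈ. -/
open Filter Topology Metric Set

noncomputable section

section Envelope

variable {α : Type*} [TopologicalSpace α] {D : Set α} {f : α → ℝ} {y : α} {c : ℝ}

theorem uscEnv_le_of_eventually_le (hy : y ∈ D) (h : ∀ᶠ z in 𝓝[D] y, f z ≤ c) :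
    uscEnv D f y ≤ c :=
  limsup_le_of_le ⟨f y, fun _ ha => (eventually_map.1 ha).self_of_nhdsWithin hy⟩ h

theorem le_uscEnv (hy : y ∈ D) (hb : IsBoundedUnder (· ≤ ·) (𝓝[D] y) f) :
    f y ≤ uscEnv D f y :=
  le_limsup_of_le hb fun _ h => h.self_of_nhdsWithin hy

theorem upperSemicontinuousOn_uscEnv
    (hb : ∀ y ∈ D, IsBoundedUnder (· ≤ ·) (𝓝[D] y) f) :
    UpperSemicontinuousOn (uscEnv D f) D := by
  intro y hy c hc
  obtain ⟨c', h₁, h₂⟩ := exists_between hc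
  have h : ∀ᶠ z in 𝓝[D] y, f z < c' := eventually_lt_of_limsup_lt h₁ (hb y hy)
  filter_upwards [eventually_eventually_nhdsWithin.2 h, self_mem_nhdsWithin] with z hz hzD
  exact (uscEnv_le_of_eventually_le hzD (hz.mono fun _ => le_of_lt)).trans_lt h₂

end Envelope

/-- Sequential continuity of a compact-valued map in the Hausdorff distance lets a property that
holds near every point of `Z y₀` propagate to all points of `Z y` for `y` near `y₀`. -/
theorem eventually_forall_mem_of_tendsto_hausdorffDist {X E : Type*} [TopologicalSpace X]
    [FirstCountableTopology X] [PseudoMetricSpace E] {Z : X → Set E} {D : Set X} {y₀ : X}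
    (hne : ∀ y ∈ D, (Z y).Nonempty) (hcp : ∀ y ∈ D, IsCompact (Z y)) (hy₀ : y₀ ∈ D)
    (hZ : ∀ p : ℕ → X, (∀ n, p n ∈ D) → Tendsto p atTop (𝓝 y₀) →
      Tendsto (fun n => hausdorffDist (Z (p n)) (Z y₀)) atTop (𝓝 0))
    {P : X → E → Prop} (hP : ∀ ζ ∈ Z y₀, ∀ᶠ q : X × E in 𝓝[D] y₀ ×ˢ 𝓝 ζ, P q.1 q.2) :
    ∀ᶠ y in 𝓝[D] y₀, ∀ ζ ∈ Z y, P y ζ := by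
  have hnhds : ∀ᶠ q : X × E in 𝓝[D] y₀ ×ˢ 𝓝ˢ (Z y₀), P q.1 q.2 :=
    (hcp y₀ hy₀).mem_prod_nhdsSet_of_forall hP
  obtain ⟨p, hp, q, hq, hpq⟩ := eventually_prod_iff.1 hnhds
  obtain ⟨ε, hε, hεq⟩ := (hcp y₀ hy₀).exists_thickening_subset_open isOpen_interior
    (subset_interior_iff_mem_nhdsSet.2 hq)
  have hdist : ∀ᶠ y in 𝓝[D] y₀, hausdorffDist (Z y) (Z y₀) < ε := by
    by_contra hcon
    have hfreq : ∃ᶠ y in 𝓝[D] y₀, y ∈ D ∧ ¬ hausdorffDist (Z y) (Z y₀) < ε :=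
      ((not_eventually.1 hcon).and_eventually self_mem_nhdsWithin).mono fun _ h => h.symm
    obtain ⟨s, hs, hsP⟩ := exists_seq_forall_of_frequently hfreq
    have := hZ s (fun n => (hsP n).1) (hs.mono_right nhdsWithin_le_nhds)
    obtain ⟨n, hn⟩ := (this.eventually_lt_const hε).exists
    exact (hsP n).2 hn
  filter_upwards [hp, hdist, self_mem_nhdsWithin] with y hpy hy hyD ζ hζ
  refine hpq hpy (interior_subset (hεq ?_))
  obtain ⟨ζ', hζ', hlt⟩ := exists_dist_lt_of_hausdorffDist_lt hζ hy
    (hausdorffEDist_ne_top_of_nonempty_of_bounded (hne y hyD) (hne y₀ hy₀)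
      (hcp y hyD).isBounded (hcp y₀ hy₀).isBounded)
  exact mem_thickening_iff.2 ⟨ζ', hζ', hlt⟩

/-- For `u` locally bounded on `[0,T] × ℝᵈ`, the function `M u*` is upper
semicontinuous on `[0,T] × ℝᵈ`, and `(M u)* ≤ M u*` pointwise on `[0,T] × ℝᵈ`. -/
theorem stmt1 {d : ℕ} (hd : 1 ≤ d) {T : ℝ} (hT : 0 < T)
    (Γ : (ℝ × Euc d) → Euc d → Euc d) (K : (ℝ × Euc d) → Euc d → ℝ)
    (Z : (ℝ × Euc d) → Set (Euc d))
    (D : Set (ℝ × Euc d)) (hD : D = Set.Icc (0:ℝ) T ×ˢ (Set.univ : Set (Euc d)))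
    (hΓ : ContinuousOn (fun p : (ℝ × Euc d) × Euc d => Γ p.1 p.2) (D ×ˢ (Set.univ : Set (Euc d))))
    (hK : ContinuousOn (fun p : (ℝ × Euc d) × Euc d => K p.1 p.2) (D ×ˢ (Set.univ : Set (Euc d))))
    (hZne : ∀ y ∈ D, (Z y).Nonempty)
    (hZcp : ∀ y ∈ D, IsCompact (Z y))
    (hZH : ∀ (p : ℕ → ℝ × Euc d) (q : ℝ × Euc d), (∀ n, p n ∈ D) → q ∈ D →
      Filter.Tendsto p Filter.atTop (𝓝 q) →
      Filter.Tendsto (fun n => Metric.hausdorffDist (Z (p n)) (Z q)) Filter.atTop (𝓝 (0:ℝ)))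
    (u : ℝ × Euc d → ℝ)
    (hu : ∀ y ∈ D, ∃ U ∈ 𝓝 y, ∃ C : ℝ, ∀ z ∈ U ∩ D, |u z| ≤ C) :
    UpperSemicontinuousOn (Mop Γ K Z (uscEnv D u)) D ∧
      ∀ y ∈ D, uscEnv D (Mop Γ K Z u) y ≤ Mop Γ K Z (uscEnv D u) y := by
  have hb : ∀ y ∈ D, IsBoundedUnder (· ≤ ·) (𝓝[D] y) u := by
    intro y hy
    obtain ⟨U, hU, C, hC⟩ := hu y hy
    refine isBoundedUnder_of_eventually_le (a := C) ?_
    filter_upwards [mem_nhdsWithin_of_mem_nhds hU, self_mem_nhdsWithin] with z hzU hzD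
    exact (abs_le.1 (hC z ⟨hzU, hzD⟩)).2
  have hmaps : ∀ y ∈ D, ∀ ζ, (y.1, Γ y ζ) ∈ D := by
    intro y hy ζ
    rw [hD] at hy ⊢
    exact ⟨hy.1, mem_univ _⟩
  have hF : UpperSemicontinuousOn (fun p : (ℝ × Euc d) × Euc d =>
      uscEnv D u (p.1.1, Γ p.1 p.2) + K p.1 p.2) (D ×ˢ univ) := by
    refine UpperSemicontinuousOn.add ?_ hK.upperSemicontinuousOn
    exact (upperSemicontinuousOn_uscEnv hb).comp
      (g := fun p : (ℝ × Euc d) × Euc d => (p.1.1, Γ p.1 p.2))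
      (continuous_fst.fst.continuousOn.prodMk hΓ) fun p hp => hmaps p.1 hp.1 p.2
  have hbdd : ∀ y ∈ D,
      BddAbove ((fun ζ => uscEnv D u (y.1, Γ y ζ) + K y ζ) '' Z y) := by
    intro y hy
    refine UpperSemicontinuousOn.bddAbove_of_isCompact (hZcp y hy) ?_
    exact hF.comp (g := fun ζ : Euc d => (y, ζ)) (by fun_prop) fun ζ _ => ⟨hy, mem_univ _⟩
  have husc : UpperSemicontinuousOn (Mop Γ K Z (uscEnv D u)) D := by
    intro y₀ hy₀ c hc
    obtain ⟨c', h₁, h₂⟩ := exists_between hc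
    have hnear := eventually_forall_mem_of_tendsto_hausdorffDist
      (P := fun y ζ => uscEnv D u (y.1, Γ y ζ) + K y ζ < c') hZne hZcp hy₀
      (fun p hp hlim => hZH p y₀ hp hy₀ hlim) fun ζ hζ => by
        have hlt := hF (y₀, ζ) ⟨hy₀, mem_univ _⟩ c'
          ((le_csSup (hbdd y₀ hy₀) (mem_image_of_mem _ hζ)).trans_lt h₁)
        rwa [nhdsWithin_prod_eq, nhdsWithin_univ] at hlt
    filter_upwards [hnear, self_mem_nhdsWithin] with y hy hyD
    refine (csSup_le ((hZne y hyD).image _) ?_).trans_lt h₂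
    rintro _ ⟨ζ, hζ, rfl⟩
    exact (hy ζ hζ).le
  refine ⟨husc, fun y hy => le_of_forall_gt_imp_ge_of_dense fun c hc => ?_⟩
  refine uscEnv_le_of_eventually_le hy ?_
  filter_upwards [husc y hy c hc, self_mem_nhdsWithin] with z hz hzD
  refine le_trans (csSup_le ((hZne z hzD).image _) ?_) hz.le
  rintro _ ⟨ζ, hζ, rfl⟩
  have hzζ := hmaps z hzD ζ
  exact (add_le_add_left (le_uscEnv hzζ (hb _ hzζ)) _).trans
    (le_csSup (hbdd z hzD) (mem_image_of_mem _ hζ))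
end
end

section
/- Let u be a locally bounded real-valued function on [0,T]×ℝᵈ, and let (t_n,x_n) → (t,x) be a sequence in [0,T]×ℝᵈ with u(t_n,x_n) → u*(t,x). If u*(t,x) > M u*(t,x), then there exists N ∈ ℕ such that u(t_n,x_n) > M u(t_n,x_n) for all n ≥ N. -/
open Filter Topology Metric Set

noncomputable section

/-- A bound on `|u|` over `U ∩ D` bounds the upper envelope at every point of `D` interior to `U`. -/
theorem uscEnv_le_of_abs_le {α : Type*} [TopologicalSpace α] {D U : Set α} {u : α → ℝ} {C : ℝ}
    {z : α} (hz : z ∈ D) (hU : U ∈ 𝓝 z) (hC : ∀ w ∈ U ∩ D, |u w| ≤ C) : uscEnv D u z ≤ C := by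
  have : (𝓝[D] z).NeBot := nhdsWithin_neBot_of_mem hz
  have h : ∀ᶠ w in 𝓝[D] z, |u w| ≤ C := by
    filter_upwards [mem_nhdsWithin_of_mem_nhds hU, self_mem_nhdsWithin] with w h₁ h₂
    exact hC w ⟨h₁, h₂⟩
  have hlow : IsBoundedUnder (· ≥ ·) (𝓝[D] z) u :=
    isBoundedUnder_of_eventually_ge (h.mono fun w hw => (abs_le.1 hw).1)
  exact limsup_le_of_le hlow.isCoboundedUnder_le (h.mono fun w hw => (abs_le.1 hw).2)

/-- If `u` is bounded near `z` within `D`, then it is eventually below any value exceeding its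
upper envelope at `z`. -/
theorem eventually_lt_of_uscEnv_lt {α : Type*} [TopologicalSpace α] {D U : Set α} {u : α → ℝ}
    {C a : ℝ} {z : α} (hU : U ∈ 𝓝 z) (hC : ∀ w ∈ U ∩ D, |u w| ≤ C) (ha : uscEnv D u z < a) :
    ∀ᶠ w in 𝓝[D] z, u w < a := by
  refine eventually_lt_of_limsup_lt ha (isBoundedUnder_of_eventually_le (a := C) ?_)
  filter_upwards [mem_nhdsWithin_of_mem_nhds hU, self_mem_nhdsWithin] with w h₁ h₂
  exact (abs_le.1 (hC w ⟨h₁, h₂⟩)).2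

/-- The upper envelope of a locally bounded function is bounded above on compact subsets. -/
theorem bddAbove_uscEnv_image {α : Type*} [TopologicalSpace α] {D S : Set α} {u : α → ℝ}
    (hu : ∀ y ∈ D, ∃ U ∈ 𝓝 y, ∃ C : ℝ, ∀ z ∈ U ∩ D, |u z| ≤ C) (hS : IsCompact S)
    (hSD : S ⊆ D) : BddAbove (uscEnv D u '' S) := by
  refine hS.induction_on (p := fun A => BddAbove (uscEnv D u '' A)) (by simp)
    (fun A B hAB hB => hB.mono (image_mono hAB))
    (fun A B hA hB => by rw [image_union]; exact hA.union hB) fun y hy => ?_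
  obtain ⟨U, hU, C, hC⟩ := hu y (hSD hy)
  refine ⟨interior U ∩ S, ?_, C, ?_⟩
  · exact inter_mem (mem_nhdsWithin_of_mem_nhds (interior_mem_nhds.2 hU)) self_mem_nhdsWithin
  · rintro _ ⟨z, ⟨hzU, hzS⟩, rfl⟩
    exact uscEnv_le_of_abs_le (hSD hzS) (mem_interior_iff_mem_nhds.1 hzU) hC

/-- Hausdorff-close sets eventually lie in any neighbourhood of a compact limit. -/
theorem eventually_subset_of_tendsto_hausdorffDist {ι E : Type*} [PseudoMetricSpace E]
    {l : Filter ι} {A : ι → Set E} {B V : Set E} (hB : IsCompact B) (hBne : B.Nonempty)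
    (hA : ∀ i, IsCompact (A i)) (hAne : ∀ i, (A i).Nonempty)
    (h : Tendsto (fun i => hausdorffDist (A i) B) l (𝓝 0)) (hV : V ∈ 𝓝ˢ B) :
    ∀ᶠ i in l, A i ⊆ V := by
  obtain ⟨W, hW, hBW, hWV⟩ := mem_nhdsSet_iff_exists.1 hV
  obtain ⟨δ, hδ, hδW⟩ := hB.exists_thickening_subset_open hW hBW
  filter_upwards [h.eventually_lt_const hδ] with i hi x hx
  obtain ⟨y, hy, hxy⟩ := exists_dist_lt_of_hausdorffDist_lt hx hi
    (hausdorffEDist_ne_top_of_nonempty_of_bounded (hAne i) hBne (hA i).isBounded hB.isBounded)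
  exact hWV (hδW (mem_thickening_iff.2 ⟨y, hy, hxy⟩))

/-- For `u` locally bounded on `[0,T] × ℝᵈ` and a sequence
`(t_n,x_n) → (t,x)` in `[0,T] × ℝᵈ` with `u(t_n,x_n) → u*(t,x)`: if `u*(t,x) > M u*(t,x)`,
then there exists `N` such that `u(t_n,x_n) > M u(t_n,x_n)` for all `n ≥ N`. -/
theorem stmt3 {d : ℕ} (hd : 1 ≤ d) {T : ℝ} (hT : 0 < T)
    (Γ : (ℝ × Euc d) → Euc d → Euc d) (K : (ℝ × Euc d) → Euc d → ℝ)
    (Z : (ℝ × Euc d) → Set (Euc d))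
    (D : Set (ℝ × Euc d)) (hD : D = Set.Icc (0:ℝ) T ×ˢ (Set.univ : Set (Euc d)))
    (hΓ : ContinuousOn (fun p : (ℝ × Euc d) × Euc d => Γ p.1 p.2) (D ×ˢ (Set.univ : Set (Euc d))))
    (hK : ContinuousOn (fun p : (ℝ × Euc d) × Euc d => K p.1 p.2) (D ×ˢ (Set.univ : Set (Euc d))))
    (hZne : ∀ y ∈ D, (Z y).Nonempty)
    (hZcp : ∀ y ∈ D, IsCompact (Z y))
    (hZH : ∀ (p : ℕ → ℝ × Euc d) (q : ℝ × Euc d), (∀ n, p n ∈ D) → q ∈ D →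
      Filter.Tendsto p Filter.atTop (𝓝 q) →
      Filter.Tendsto (fun n => Metric.hausdorffDist (Z (p n)) (Z q)) Filter.atTop (𝓝 (0:ℝ)))
    (u : ℝ × Euc d → ℝ)
    (hu : ∀ y ∈ D, ∃ U ∈ 𝓝 y, ∃ C : ℝ, ∀ z ∈ U ∩ D, |u z| ≤ C)
    (p : ℕ → ℝ × Euc d) (q : ℝ × Euc d) (hpD : ∀ n, p n ∈ D) (hqD : q ∈ D)
    (hpq : Filter.Tendsto p Filter.atTop (𝓝 q))
    (hpu : Filter.Tendsto (fun n => u (p n)) Filter.atTop (𝓝 (uscEnv D u q)))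
    (hgt : Mop Γ K Z (uscEnv D u) q < uscEnv D u q) :
    ∃ N : ℕ, ∀ n ≥ N, Mop Γ K Z u (p n) < u (p n) := by
  have hmaps : ∀ y ∈ D, ∀ x : Euc d, (y.1, x) ∈ D := by
    intro y hy x
    rw [hD] at hy ⊢
    exact ⟨hy.1, mem_univ _⟩
  have hmem : ∀ ζ, (q, ζ) ∈ D ×ˢ (univ : Set (Euc d)) := fun ζ => ⟨hqD, mem_univ _⟩
  have hΓq : Continuous (Γ q) := hΓ.comp_continuous (Continuous.prodMk_right q) hmem
  have hKq : Continuous (K q) := hK.comp_continuous (Continuous.prodMk_right q) hmem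
  have hbdd : BddAbove ((fun ζ => uscEnv D u (q.1, Γ q ζ) + K q ζ) '' Z q) := by
    obtain ⟨a, ha⟩ := bddAbove_uscEnv_image hu
      ((hZcp q hqD).image (f := fun ζ => (q.1, Γ q ζ)) (by fun_prop))
      (by rintro _ ⟨ζ, -, rfl⟩; exact hmaps q hqD _)
    obtain ⟨b, hb⟩ := (hZcp q hqD).bddAbove_image hKq.continuousOn
    refine ⟨a + b, ?_⟩
    rintro _ ⟨ζ, hζ, rfl⟩
    exact add_le_add (ha ⟨_, ⟨ζ, hζ, rfl⟩, rfl⟩) (hb ⟨ζ, hζ, rfl⟩)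
  obtain ⟨c, hMc, hcu⟩ := exists_between hgt
  have hloc : ∀ ζ ∈ Z q, {r : (ℝ × Euc d) × Euc d | u (r.1.1, Γ r.1 r.2) + K r.1 r.2 < c} ∈
      𝓝[D] q ×ˢ 𝓝 ζ := by
    intro ζ hζ
    have hlt : uscEnv D u (q.1, Γ q ζ) + K q ζ < c := (le_csSup hbdd ⟨ζ, hζ, rfl⟩).trans_lt hMc
    obtain ⟨a, ha, hac⟩ := exists_between (lt_sub_iff_add_lt.2 hlt)
    have hprod : 𝓝[D] q ×ˢ 𝓝 ζ = 𝓝[D ×ˢ (univ : Set (Euc d))] (q, ζ) := by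
      rw [nhdsWithin_prod_eq, nhdsWithin_univ]
    have hΦ : Tendsto (fun r : (ℝ × Euc d) × Euc d => (r.1.1, Γ r.1 r.2))
        (𝓝[D ×ˢ (univ : Set (Euc d))] (q, ζ)) (𝓝[D] (q.1, Γ q ζ)) := by
      refine tendsto_nhdsWithin_iff.2 ⟨?_, ?_⟩
      · exact ContinuousWithinAt.prodMk (by fun_prop) (hΓ (q, ζ) (hmem ζ))
      · filter_upwards [self_mem_nhdsWithin] with r hr
        exact hmaps r.1 hr.1 _
    obtain ⟨U, hU, C, hC⟩ := hu _ (hmaps q hqD (Γ q ζ))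
    rw [hprod]
    filter_upwards [hΦ.eventually (eventually_lt_of_uscEnv_lt hU hC ha),
      (hK (q, ζ) (hmem ζ)).eventually_lt_const (lt_sub_comm.1 hac)] with r h₁ h₂
    have h₃ : K r.1 r.2 < c - a := h₂
    change u (r.1.1, Γ r.1 r.2) + K r.1 r.2 < c
    linarith
  obtain ⟨A, hA, V, hV, hAV⟩ :=
    mem_prod_iff.1 ((hZcp q hqD).mem_prod_nhdsSet_of_forall hloc)
  have hsub := eventually_subset_of_tendsto_hausdorffDist (hZcp q hqD) (hZne q hqD)
    (fun n => hZcp _ (hpD n)) (fun n => hZne _ (hpD n)) (hZH p q hpD hqD hpq) hV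
  have hpA := (tendsto_nhdsWithin_iff.2 ⟨hpq, Eventually.of_forall hpD⟩).eventually hA
  refine eventually_atTop.1 ?_
  filter_upwards [hsub, hpA, hpu.eventually_const_lt hcu] with n h₁ h₂ h₃
  refine lt_of_le_of_lt (csSup_le ((hZne _ (hpD n)).image _) ?_) h₃
  rintro _ ⟨ζ, hζ, rfl⟩
  exact le_of_lt (hAV (mk_mem_prod h₂ (h₁ hζ)))
end
end

section
/- Fix δ ∈ (0,1). Let β_k → β in B, x_k → x in ℝᵈ, p_k → p in ℝᵈ, and let u ∈ PB be upper semicontinuous with u(x_k) → u(x). Then limsup_{k→∞} I^{2,δ}_{β_k}[x_k, p_k, u] ≤ I^{2,δ}_β[x, p, u]. -/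
open Filter Topology Metric Set MeasureTheory
open scoped RealInnerProductSpace ENNReal

noncomputable section

/-- Membership in the space `PB` of measurable, polynomially bounded functions of order `b`. -/
def PB {d : ℕ} (b : ℝ) (u : Euc d → ℝ) : Prop :=
  Measurable u ∧ ∃ C : ℝ, ∀ y : Euc d, |u y| ≤ C * (1 + ‖y‖ ^ b)

/-- The nonlocal operator
`I^{2,δ}_β[x,p,u] = ∫_{|z|≥δ} [u(x+ℓ(x,β,z)) − u(x) − ⟨p, ℓ(x,β,z)⟩·1_{|z|<1}] ν(dz)`. -/
noncomputable def I2 {d k : ℕ} {B : Type*} (ν : Measure (Euc k))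
    (ℓ : Euc d → B → Euc k → Euc d) (δ : ℝ) (β : B) (x p : Euc d) (u : Euc d → ℝ) : ℝ :=
  ∫ z in {z : Euc k | δ ≤ ‖z‖},
    (u (x + ℓ x β z) - u x - (if ‖z‖ < 1 then ⟪p, ℓ x β z⟫ else 0)) ∂ν

/-- A Lévy measure charges the complement of every ball around the origin finitely, so that the
tail moment of order `r` is finite as soon as it is finite outside the unit ball. -/
lemma integrableOn_max_one_norm_rpow {k : ℕ} {ν : Measure (Euc k)} {r δ : ℝ} (hδ : 0 < δ)
    (hν : (∫⁻ z, ENNReal.ofReal (min (‖z‖ ^ 2) 1) ∂ν) ≠ ⊤)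
    (hνr : (∫⁻ z in {z : Euc k | 1 ≤ ‖z‖}, ENNReal.ofReal (‖z‖ ^ r) ∂ν) ≠ ⊤) :
    IntegrableOn (fun z : Euc k => max 1 ‖z‖ ^ r) {z | δ ≤ ‖z‖} ν := by
  have hfar_meas : MeasurableSet {z : Euc k | 1 ≤ ‖z‖} :=
    measurableSet_le measurable_const measurable_norm
  have hnear_meas : MeasurableSet {z : Euc k | δ ≤ ‖z‖ ∧ ‖z‖ < 1} :=
    (measurableSet_le measurable_const measurable_norm).inter
      (measurableSet_lt measurable_norm measurable_const)
  have hfin : ν {z : Euc k | δ ≤ ‖z‖ ∧ ‖z‖ < 1} < ⊤ := by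
    have hε : ENNReal.ofReal (min (δ ^ 2) 1) ≠ 0 := by
      simpa using hδ.ne'
    refine (measure_mono fun z hz => ?_).trans_lt
      ((meas_ge_le_lintegral_div (by fun_prop) hε ENNReal.ofReal_ne_top).trans_lt
        (ENNReal.div_lt_top hν hε))
    have := hz.1
    simp only [mem_ofPred_eq]
    gcongr
  have hnear : IntegrableOn (fun z : Euc k => max 1 ‖z‖ ^ r) {z | δ ≤ ‖z‖ ∧ ‖z‖ < 1} ν := by
    refine (integrableOn_const (C := (1 : ℝ)) hfin.ne).congr_fun (fun z hz => ?_) hnear_meas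
    simp [max_eq_left hz.2.le]
  have hfar : IntegrableOn (fun z : Euc k => max 1 ‖z‖ ^ r) {z | 1 ≤ ‖z‖} ν := by
    have : IntegrableOn (fun z : Euc k => ‖z‖ ^ r) {z | 1 ≤ ‖z‖} ν := by
      refine ⟨(by fun_prop : Measurable fun z : Euc k => ‖z‖ ^ r).aestronglyMeasurable, ?_⟩
      rw [hasFiniteIntegral_iff_ofReal (ae_of_all _ fun z => by positivity)]
      exact hνr.lt_top
    refine this.congr_fun (fun z hz => ?_) hfar_meas
    simp only [max_eq_right (show 1 ≤ ‖z‖ from hz)]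
  refine (hnear.union hfar).mono_set fun z hz => ?_
  rcases lt_or_ge ‖z‖ 1 with h | h
  · exact Or.inl ⟨hz, h⟩
  · exact Or.inr h

/-- Local domination of the integrand of `I2`. -/
lemma abs_integrand_le {d : ℕ} {a b r R P L C m : ℝ} (ha : 0 ≤ a) (hb : 0 ≤ b) (hr : 0 ≤ r)
    (hab : a * b ≤ r) (hC : 0 ≤ C) (hL : 0 ≤ L) {u : Euc d → ℝ}
    (hu : ∀ y, |u y| ≤ C * (1 + ‖y‖ ^ b)) {x p l : Euc d} (hx : ‖x‖ ≤ R) (hp : ‖p‖ ≤ P)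
    (hl : ‖l‖ ≤ L * max 1 m ^ a) :
    |u (x + l) - u x - (if m < 1 then ⟪p, l⟫ else 0)| ≤
      (C * (1 + (R + L) ^ b) + C * (1 + R ^ b) + P * L) * max 1 m ^ r := by
  have hR : 0 ≤ R := (norm_nonneg _).trans hx
  have hP : 0 ≤ P := (norm_nonneg _).trans hp
  set M := max 1 m
  have hM1 : 1 ≤ M := le_max_left _ _
  have hMr : 1 ≤ M ^ r := Real.one_le_rpow hM1 hr
  have hMa : 1 ≤ M ^ a := Real.one_le_rpow hM1 ha
  have hshift : ‖x + l‖ ^ b ≤ (R + L) ^ b * M ^ r := by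
    calc ‖x + l‖ ^ b ≤ ((R + L) * M ^ a) ^ b := by
          gcongr
          refine (norm_add_le _ _).trans ?_
          nlinarith
      _ = (R + L) ^ b * M ^ (a * b) := by
          rw [Real.mul_rpow (by positivity) (by positivity), Real.rpow_mul (by positivity)]
      _ ≤ (R + L) ^ b * M ^ r := by gcongr
  have h1 : |u (x + l)| ≤ C * (1 + (R + L) ^ b) * M ^ r := by
    refine (hu _).trans ?_
    rw [mul_assoc]
    gcongr
    linarith
  have h2 : |u x| ≤ C * (1 + R ^ b) * M ^ r :=
    calc |u x| ≤ C * (1 + ‖x‖ ^ b) := hu x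
      _ ≤ C * (1 + R ^ b) := by gcongr
      _ ≤ C * (1 + R ^ b) * M ^ r := le_mul_of_one_le_right (by positivity) hMr
  have h3 : |if m < 1 then ⟪p, l⟫ else 0| ≤ P * L * M ^ r := by
    split_ifs with h
    · have hM' : M = 1 := max_eq_left h.le
      rw [hM', Real.one_rpow, mul_one] at hl ⊢
      exact (abs_real_inner_le_norm p l).trans (by gcongr)
    · simp only [abs_zero]
      positivity
  calc |u (x + l) - u x - (if m < 1 then ⟪p, l⟫ else 0)|
      ≤ |u (x + l)| + |u x| + |if m < 1 then ⟪p, l⟫ else 0| :=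
        (abs_sub _ _).trans (add_le_add_left (abs_sub _ _) _)
    _ ≤ _ := by linarith

/-- Reverse Fatou lemma for dominated sequences of real functions. -/
lemma limsup_integral_le_integral {α : Type*} [MeasurableSpace α] {μ : Measure α}
    {f : ℕ → α → ℝ} {g G : α → ℝ} (hf : ∀ᶠ n in atTop, AEStronglyMeasurable (f n) μ)
    (hg : Integrable g μ) (hG : Integrable G μ) (hfG : ∀ᶠ n in atTop, ∀ᵐ z ∂μ, |f n z| ≤ G z)
    (hlim : ∀ᵐ z ∂μ, ∀ ε > 0, ∀ᶠ n in atTop, f n z < g z + ε) :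
    limsup (fun n => ∫ z, f n z ∂μ) atTop ≤ ∫ z, g z ∂μ := by
  have hpos : Tendsto (fun n => ∫ z, max (f n z - g z) 0 ∂μ) atTop (𝓝 0) := by
    suffices Tendsto (fun n => ∫ z, max (f n z - g z) 0 ∂μ) atTop (𝓝 (∫ _, (0 : ℝ) ∂μ)) by
      simpa using this
    refine tendsto_integral_filter_of_dominated_convergence (fun z => G z + |g z|) ?_ ?_
      (hG.add hg.abs) ?_
    · filter_upwards [hf] with n hn
      exact (hn.sub hg.1).sup aestronglyMeasurable_const
    · filter_upwards [hfG] with n hn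
      filter_upwards [hn] with z hz
      rw [Real.norm_of_nonneg (le_max_right _ _)]
      have := abs_le.1 hz
      exact max_le (by linarith [neg_abs_le (g z)]) (by linarith [abs_nonneg (g z)])
    · filter_upwards [hlim] with z hz
      rw [Metric.tendsto_nhds]
      intro ε hε
      filter_upwards [hz ε hε] with n hn
      rw [Real.dist_eq, sub_zero, abs_of_nonneg (le_max_right _ _)]
      exact max_lt (by linarith) hε
  have hbound := (tendsto_const_nhds (x := ∫ z, g z ∂μ)).add hpos
  rw [add_zero] at hbound
  rw [← hbound.limsup_eq]
  refine limsup_le_limsup ?_ (IsBoundedUnder.isCoboundedUnder_le ?_) hbound.isBoundedUnder_le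
  · filter_upwards [hf, hfG] with n hn hnG
    have hfn : Integrable (f n) μ := hG.mono' hn hnG
    have hmax : Integrable (fun z => max (f n z - g z) 0) μ := (hfn.sub hg).pos_part
    rw [← integral_add hg hmax]
    refine integral_mono hfn (hg.add hmax) fun z => ?_
    linarith [le_max_left (f n z - g z) 0]
  · refine isBoundedUnder_of_eventually_ge (a := -∫ z, G z ∂μ) ?_
    filter_upwards [hfG] with n hnG
    have := norm_integral_le_of_norm_le (f := f n) hG hnG
    exact (abs_le.1 this).1

/-- for `δ ∈ (0,1)`, `β_k → β`, `x_k → x`, `p_k → p`, and `u ∈ PB` upper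
semicontinuous with `u(x_k) → u(x)`:
`limsup_k I^{2,δ}_{β_k}[x_k,p_k,u] ≤ I^{2,δ}_β[x,p,u]`. -/
theorem stmt8 {d k : ℕ} (hd : 1 ≤ d) (hk : 1 ≤ k)
    {B : Type*} [MetricSpace B] [CompactSpace B] [Nonempty B]
    (ν : Measure (Euc k))
    (hν : (∫⁻ z, ENNReal.ofReal (min (‖z‖ ^ 2) 1) ∂ν) ≠ ⊤)
    (ℓ : Euc d → B → Euc k → Euc d)
    (hℓ : Continuous (fun q : Euc d × B × Euc k => ℓ q.1 q.2.1 q.2.2))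
    (a b pstar qstar : ℝ) (ha : 0 ≤ a) (hb : 0 ≤ b) (hpstar : 0 < pstar)
    (hab : a * b ≤ pstar) (hqstar : 0 ≤ qstar)
    (hνp : (∫⁻ z in {z : Euc k | 1 ≤ ‖z‖}, ENNReal.ofReal (‖z‖ ^ pstar) ∂ν) ≠ ⊤)
    (hνq : (∫⁻ z in {z : Euc k | ‖z‖ < 1}, ENNReal.ofReal (‖z‖ ^ qstar) ∂ν) ≠ ⊤)
    (hgrowth : ∀ x : Euc d, ∃ U ∈ 𝓝 x, ∃ C : ℝ, ∀ x' ∈ U, ∀ (β : B) (z : Euc k),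
      (1 ≤ ‖z‖ → ‖ℓ x' β z‖ ≤ C * (1 + ‖z‖ ^ a)) ∧
      (‖z‖ < 1 → ‖ℓ x' β z‖ ≤ C * ‖z‖ ^ (qstar / 2)))
    (δ : ℝ) (hδ : δ ∈ Set.Ioo (0:ℝ) 1)
    (βk : ℕ → B) (β : B) (hβ : Filter.Tendsto βk Filter.atTop (𝓝 β))
    (xk : ℕ → Euc d) (x : Euc d) (hx : Filter.Tendsto xk Filter.atTop (𝓝 x))
    (pk : ℕ → Euc d) (p : Euc d) (hp : Filter.Tendsto pk Filter.atTop (𝓝 p))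
    (u : Euc d → ℝ) (hu : PB b u) (husc : UpperSemicontinuous u)
    (huc : Filter.Tendsto (fun j => u (xk j)) Filter.atTop (𝓝 (u x))) :
    Filter.limsup (fun j => I2 ν ℓ δ (βk j) (xk j) (pk j) u) Filter.atTop ≤
      I2 ν ℓ δ β x p u := by
  obtain ⟨hum, C, hC⟩ := hu
  obtain ⟨U, hU, D, hD⟩ := hgrowth x
  obtain ⟨hδ0, -⟩ := hδ
  have hC0 : ∀ y, |u y| ≤ |C| * (1 + ‖y‖ ^ b) := fun y =>
    (hC y).trans (mul_le_mul_of_nonneg_right (le_abs_self C) (by positivity))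
  have hℓU : ∀ y ∈ U, ∀ (γ : B) (z : Euc k), ‖ℓ y γ z‖ ≤ 2 * |D| * max 1 ‖z‖ ^ a := by
    intro y hy γ z
    rcases lt_or_ge ‖z‖ 1 with hz | hz
    · have hle : ‖z‖ ^ (qstar / 2) ≤ 1 :=
        Real.rpow_le_one (norm_nonneg _) hz.le (by positivity)
      calc ‖ℓ y γ z‖ ≤ D * ‖z‖ ^ (qstar / 2) := (hD y hy γ z).2 hz
        _ ≤ |D| * 1 := by
          gcongr
          exact le_abs_self D
        _ ≤ 2 * |D| * max 1 ‖z‖ ^ a := by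
          rw [max_eq_left hz.le, Real.one_rpow]
          linarith [abs_nonneg D]
    · have hle : 1 ≤ ‖z‖ ^ a := Real.one_le_rpow hz ha
      calc ‖ℓ y γ z‖ ≤ D * (1 + ‖z‖ ^ a) := (hD y hy γ z).1 hz
        _ ≤ |D| * (‖z‖ ^ a + ‖z‖ ^ a) := by
          gcongr
          exact le_abs_self D
        _ = 2 * |D| * max 1 ‖z‖ ^ a := by
          rw [max_eq_right hz]
          ring
  have hℓc : ∀ y γ, Continuous (ℓ y γ) := fun y γ =>
    hℓ.comp (by fun_prop : Continuous fun z : Euc k => (y, γ, z))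
  have hmeas : ∀ (y : Euc d) (γ : B) (q : Euc d), Measurable fun z : Euc k =>
      u (y + ℓ y γ z) - u y - (if ‖z‖ < 1 then ⟪q, ℓ y γ z⟫ else 0) := by
    intro y γ q
    have hm := (hℓc y γ).measurable
    refine ((hum.comp (hm.const_add y)).sub_const _).sub (Measurable.ite ?_ ?_ measurable_const)
    · exact measurableSet_lt measurable_norm measurable_const
    · exact (continuous_const.inner (hℓc y γ)).measurable
  set K := |C| * (1 + (‖x‖ + 1 + 2 * |D|) ^ b) + |C| * (1 + (‖x‖ + 1) ^ b)
    + (‖p‖ + 1) * (2 * |D|)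
  have hdom : ∀ y ∈ U, ‖y‖ ≤ ‖x‖ + 1 → ∀ q : Euc d, ‖q‖ ≤ ‖p‖ + 1 → ∀ (γ : B) (z : Euc k),
      |u (y + ℓ y γ z) - u y - (if ‖z‖ < 1 then ⟪q, ℓ y γ z⟫ else 0)| ≤
        K * max 1 ‖z‖ ^ pstar := fun y hy hyR q hq γ z =>
    abs_integrand_le ha hb hpstar.le hab (abs_nonneg C) (by positivity) hC0 hyR hq
      (hℓU y hy γ z)
  have hG : Integrable (fun z : Euc k => K * max 1 ‖z‖ ^ pstar)
      (ν.restrict {z | δ ≤ ‖z‖}) :=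
    (integrableOn_max_one_norm_rpow hδ0 hν hνp).const_mul K
  refine limsup_integral_le_integral (Eventually.of_forall fun n =>
    (hmeas _ _ _).aestronglyMeasurable) (hG.mono' (hmeas _ _ _).aestronglyMeasurable
      (ae_of_all _ fun z => hdom x (mem_of_mem_nhds hU) (by linarith) p (by linarith) β z)) hG
    ?_ (ae_of_all _ fun z ε hε => ?_)
  · filter_upwards [hx.eventually_mem hU,
      hx.norm.eventually_le_const (lt_add_one ‖x‖),
      hp.norm.eventually_le_const (lt_add_one ‖p‖)] with n hnU hnx hnp
    exact ae_of_all _ fun z => hdom _ hnU hnx _ hnp _ z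
  · have hℓz : Tendsto (fun n => ℓ (xk n) (βk n) z) atTop (𝓝 (ℓ x β z)) :=
      (hℓ.tendsto (x, β, z)).comp (hx.prodMk_nhds (hβ.prodMk_nhds tendsto_const_nhds))
    have hrest : Tendsto (fun n => u (xk n) +
        (if ‖z‖ < 1 then ⟪pk n, ℓ (xk n) (βk n) z⟫ else 0)) atTop
        (𝓝 (u x + (if ‖z‖ < 1 then ⟪p, ℓ x β z⟫ else 0))) := by
      refine huc.add ?_
      split_ifs
      · exact hp.inner hℓz
      · exact tendsto_const_nhds
    filter_upwards [(hx.add hℓz).eventually (husc (x + ℓ x β z) (u (x + ℓ x β z) + ε / 2)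
        (by linarith)), hrest.eventually_const_lt (sub_lt_self _ (half_pos hε))] with n h1 h2
    linarith
end
end

section
/- Fix δ ∈ (0,1). For every φ ∈ C²(ℝᵈ), the map (x,β) ↦ I^{1,δ}_β[x,φ] is continuous on ℝᵈ×B. Moreover, if β_k → β in B, x_k → x in ℝᵈ, and (φ_k) ⊂ C²(ℝᵈ) converges monotonically (pointwise) to φ ∈ C²(ℝᵈ) with φ_k = φ on a fixed neighbourhood of x, then lim_{k→∞} I^{1,δ}_{β_k}[x_k, φ_k] = I^{1,δ}_β[x, φ]. -/
open Filter Topology Metric Set MeasureTheory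
open scoped RealInnerProductSpace ENNReal

noncomputable section

/-- The singular-part operator
`I^{1,δ}_β[x,φ] = ∫_{|z|<δ} [φ(x+ℓ(x,β,z)) − φ(x) − ⟨∇φ(x), ℓ(x,β,z)⟩] ν(dz)`. -/
noncomputable def I1 {d k : ℕ} {B : Type*} (ν : Measure (Euc k))
    (ℓ : Euc d → B → Euc k → Euc d) (δ : ℝ) (β : B) (x : Euc d) (φ : Euc d → ℝ) : ℝ :=
  ∫ z in {z : Euc k | ‖z‖ < δ},
    (φ (x + ℓ x β z) - φ x - ⟪gradient φ x, ℓ x β z⟫) ∂ν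

/-- Second-order Taylor bound for `C²` functions on a ball. -/
theorem ContDiff.exists_abs_sub_sub_inner_gradient_le {E : Type*} [NormedAddCommGroup E]
    [InnerProductSpace ℝ E] [FiniteDimensional ℝ E] {φ : E → ℝ}
    (hφ : ContDiff ℝ 2 φ) (R : ℝ) :
    ∃ M : ℝ, 0 ≤ M ∧ ∀ x h : E, ‖x‖ ≤ R → ‖x + h‖ ≤ R →
      |φ (x + h) - φ x - ⟪gradient φ x, h⟫| ≤ M * ‖h‖ ^ 2 := by
  have hd : Differentiable ℝ φ := hφ.differentiable (by norm_num)
  have h1 : ContDiff ℝ 1 (fderiv ℝ φ) := hφ.fderiv_right (by norm_num)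
  have hd1 : Differentiable ℝ (fderiv ℝ φ) := h1.differentiable (by norm_num)
  have hc : Continuous (fderiv ℝ (fderiv ℝ φ)) := h1.continuous_fderiv (by norm_num)
  obtain ⟨M, hM⟩ := (isCompact_closedBall (0 : E) R).exists_bound_of_continuousOn
    (f := fderiv ℝ (fderiv ℝ φ))
    hc.continuousOn
  refine ⟨max M 0, le_max_right _ _, fun x h hx hxh => ?_⟩
  have hx' : x ∈ closedBall (0 : E) R := by simpa using hx
  have hxh' : x + h ∈ closedBall (0 : E) R := by simpa using hxh
  have hsub : segment ℝ x (x + h) ⊆ closedBall (0 : E) R :=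
    (convex_closedBall (0 : E) R).segment_subset hx' hxh'
  have hlip : ∀ y ∈ segment ℝ x (x + h), ‖fderiv ℝ φ y - fderiv ℝ φ x‖ ≤ max M 0 * ‖h‖ := by
    intro y hy
    have h2 := (convex_closedBall (0 : E) R).norm_image_sub_le_of_norm_fderiv_le
      (fun z _ => hd1 z) (fun z hz => (hM z hz).trans (le_max_left M 0)) hx' (hsub hy)
    have h3 : ‖y - x‖ ≤ ‖h‖ := by
      simpa using norm_sub_le_of_mem_segment hy
    exact h2.trans (by gcongr)
  have h4 := (convex_segment x (x + h)).norm_image_sub_le_of_norm_fderiv_le'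
    (fun z _ => hd z) hlip (left_mem_segment ℝ _ _) (right_mem_segment ℝ _ _)
  rw [inner_gradient_left]
  simpa [pow_two, mul_assoc] using h4

/-- A monotone sequence of continuous functions with continuous pointwise limit converges
continuously. -/
theorem tendsto_apply_of_monotone_or_antitone {X : Type*} [TopologicalSpace X]
    {F : ℕ → X → ℝ} {f : X → ℝ} (hF : ∀ j, Continuous (F j)) (hf : Continuous f)
    (hmono : (∀ y, Monotone fun j => F j y) ∨ (∀ y, Antitone fun j => F j y))
    (hlim : ∀ y, Tendsto (fun j => F j y) atTop (𝓝 (f y)))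
    {u : ℕ → X} {y : X} (hu : Tendsto u atTop (𝓝 y)) :
    Tendsto (fun j => F j (u j)) atTop (𝓝 (f y)) := by
  have h : TendstoLocallyUniformly F f atTop := by
    rcases hmono with h | h
    · exact Monotone.tendstoLocallyUniformly_of_forall_tendsto hF (fun i j hij y => h y hij) hf hlim
    · exact Antitone.tendstoLocallyUniformly_of_forall_tendsto hF (fun i j hij y => h y hij) hf hlim
  exact h.tendsto_comp hf.continuousAt hu

theorem abs_sub_lim_le_of_monotone_or_antitone {u : ℕ → ℝ} {l : ℝ}
    (hmono : Monotone u ∨ Antitone u) (hlim : Tendsto u atTop (𝓝 l)) (j : ℕ) :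
    |u j - l| ≤ |u 0 - l| := by
  rcases hmono with h | h
  · have h1 := h (Nat.zero_le j)
    have h2 := h.ge_of_tendsto hlim j
    rw [abs_of_nonpos (by linarith), abs_of_nonpos (by linarith)]
    linarith
  · have h1 := h (Nat.zero_le j)
    have h2 := h.le_of_tendsto hlim j
    rw [abs_of_nonneg (by linarith), abs_of_nonneg (by linarith)]
    linarith

theorem integrableOn_norm_rpow {E : Type*} [NormedAddCommGroup E] [MeasurableSpace E]
    [OpensMeasurableSpace E] {μ : Measure E} {s : Set E} {q : ℝ}
    (h : (∫⁻ z in s, ENNReal.ofReal (‖z‖ ^ q) ∂μ) ≠ ⊤) :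
    IntegrableOn (fun z : E => ‖z‖ ^ q) s μ := by
  refine ⟨(measurable_norm.pow_const q).aestronglyMeasurable, ?_⟩
  rw [hasFiniteIntegral_iff_ofReal (ae_of_all _ fun z => by positivity)]
  exact h.lt_top

/-- Continuity of the singular part along sequences of points, controls and test functions. -/
theorem tendsto_I1 {d k : ℕ} {B : Type*} [TopologicalSpace B] {ν : Measure (Euc k)}
    {ℓ : Euc d → B → Euc k → Euc d}
    (hℓ : Continuous (fun q : Euc d × B × Euc k => ℓ q.1 q.2.1 q.2.2))
    {q δ : ℝ} (hq : 0 ≤ q) (hδ : δ < 1)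
    (hνq : (∫⁻ z in {z : Euc k | ‖z‖ < 1}, ENNReal.ofReal (‖z‖ ^ q) ∂ν) ≠ ⊤)
    {x : Euc d}
    (hgrowth : ∃ U ∈ 𝓝 x, ∃ C : ℝ, ∀ x' ∈ U, ∀ (β : B) (z : Euc k),
      ‖z‖ < 1 → ‖ℓ x' β z‖ ≤ C * ‖z‖ ^ (q / 2))
    {βk : ℕ → B} {β : B} (hβ : Tendsto βk atTop (𝓝 β))
    {xk : ℕ → Euc d} (hx : Tendsto xk atTop (𝓝 x))
    {φ : Euc d → ℝ} (hφ : ContDiff ℝ 2 φ)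
    {φk : ℕ → Euc d → ℝ} (hφk : ∀ j, ContDiff ℝ 2 (φk j))
    (hmono : (∀ y, Monotone fun j => φk j y) ∨ (∀ y, Antitone fun j => φk j y))
    (hlim : ∀ y, Tendsto (fun j => φk j y) atTop (𝓝 (φ y)))
    (hloc : ∃ U ∈ 𝓝 x, ∀ j, ∀ y ∈ U, φk j y = φ y) :
    Tendsto (fun j => I1 ν ℓ δ (βk j) (xk j) (φk j)) atTop (𝓝 (I1 ν ℓ δ β x φ)) := by
  obtain ⟨U, hU, C₀, hC₀⟩ := hgrowth
  obtain ⟨V, hV, hVeq⟩ := hloc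
  obtain ⟨ε, hε, hεV⟩ := Metric.mem_nhds_iff.1 hV
  obtain ⟨C, hC, hCℓ⟩ : ∃ C : ℝ, 0 ≤ C ∧ ∀ x' ∈ U, ∀ (β : B) (z : Euc k),
      ‖z‖ < 1 → ‖ℓ x' β z‖ ≤ C * ‖z‖ ^ (q / 2) :=
    ⟨max C₀ 0, le_max_right _ _, fun x' hx' β z hz => (hC₀ x' hx' β z hz).trans (by
      gcongr; exact le_max_left _ _)⟩
  obtain ⟨M, hM, hMφ⟩ := hφ.exists_abs_sub_sub_inner_gradient_le (‖x‖ + 1 + C)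
  obtain ⟨K₀, hK₀⟩ := (isCompact_closedBall (0 : Euc d) (‖x‖ + 1 + C)).exists_bound_of_continuousOn
    ((hφk 0).continuous.sub hφ.continuous).continuousOn
  obtain ⟨K, hK, hKφ⟩ : ∃ K : ℝ, 0 ≤ K ∧ ∀ y : Euc d, ‖y‖ ≤ ‖x‖ + 1 + C →
      ∀ j, |φk j y - φ y| ≤ K := by
    refine ⟨max K₀ 0, le_max_right _ _, fun y hy j => ?_⟩
    have h1 : |φk j y - φ y| ≤ |φk 0 y - φ y| :=
      abs_sub_lim_le_of_monotone_or_antitone (hmono.imp (· y) (· y)) (hlim y) j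
    exact h1.trans ((hK₀ y (by simpa using hy)).trans (le_max_left _ _))
  have hgrad : Continuous (gradient φ) :=
    (InnerProductSpace.toDual ℝ (Euc d)).symm.continuous.comp
      (hφ.continuous_fderiv (by norm_num))
  have hnear : ∀ᶠ j in atTop, xk j ∈ U ∧ ‖xk j - x‖ < 1 ∧ ‖xk j - x‖ < ε / 2 := by
    have h1 := hx.eventually hU
    have h2 := hx.eventually (Metric.ball_mem_nhds x one_pos)
    have h3 := hx.eventually (Metric.ball_mem_nhds x (half_pos hε))
    filter_upwards [h1, h2, h3] with j h1 h2 h3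
    exact ⟨h1, by simpa [dist_eq_norm] using h2, by simpa [dist_eq_norm] using h3⟩
  have hgradk : ∀ᶠ j in atTop, φk j (xk j) = φ (xk j) ∧
      gradient (φk j) (xk j) = gradient φ (xk j) := by
    filter_upwards [hx.eventually (eventually_mem_nhds_iff.2 hV)] with j hj
    refine ⟨hVeq j _ (mem_of_mem_nhds hj), ?_⟩
    have h1 : φk j =ᶠ[𝓝 (xk j)] φ := by
      filter_upwards [hj] with y hy using hVeq j y hy
    rw [gradient, gradient, h1.fderiv_eq]
  have hball : MeasurableSet {z : Euc k | ‖z‖ < δ} :=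
    measurableSet_lt measurable_norm measurable_const
  have hℓz : ∀ (x : Euc d) (β : B), Continuous (ℓ x β) := fun x β =>
    hℓ.comp (by fun_prop : Continuous fun z : Euc k => (x, β, z))
  unfold I1
  refine tendsto_integral_filter_of_dominated_convergence
    (fun z => (M + K / (ε / 2) ^ 2) * C ^ 2 * ‖z‖ ^ q) ?_ ?_ ?_ ?_
  · refine Eventually.of_forall fun j => Continuous.aestronglyMeasurable ?_
    have h1 := (hφk j).continuous
    have h2 := hℓz (xk j) (βk j)
    fun_prop
  · filter_upwards [hnear, hgradk] with j ⟨hjU, hj1, hjε⟩ ⟨hj, hjg⟩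
    refine (ae_restrict_iff' hball).2 (ae_of_all _ fun z hz => ?_)
    have hz1 : ‖z‖ < 1 := lt_trans hz hδ
    have hb := hCℓ _ hjU (βk j) z hz1
    set h := ℓ (xk j) (βk j) z
    have hbC : ‖h‖ ≤ C := hb.trans
      (mul_le_of_le_one_right hC (Real.rpow_le_one (norm_nonneg _) hz1.le (by linarith)))
    have hsq : ‖h‖ ^ 2 ≤ C ^ 2 * ‖z‖ ^ q := by
      calc ‖h‖ ^ 2 ≤ (C * ‖z‖ ^ (q / 2)) ^ 2 := by gcongr
        _ = C ^ 2 * ‖z‖ ^ q := by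
          rw [mul_pow, ← Real.rpow_mul_natCast (norm_nonneg _)]
          norm_num
    have hxj : ‖xk j‖ ≤ ‖x‖ + 1 := by
      have := norm_sub_norm_le (xk j) x
      linarith
    have hxh : ‖xk j + h‖ ≤ ‖x‖ + 1 + C := (norm_add_le _ _).trans (by linarith)
    have htaylor := hMφ (xk j) h (by linarith) hxh
    have hdiff : |φk j (xk j + h) - φ (xk j + h)| ≤ K / (ε / 2) ^ 2 * ‖h‖ ^ 2 := by
      rcases lt_or_ge ‖h‖ (ε / 2) with hlt | hge
      · have hmem : xk j + h ∈ V := hεV (by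
          rw [mem_ball, dist_eq_norm, add_sub_right_comm]
          exact (norm_add_le _ _).trans_lt (by linarith))
        rw [hVeq j _ hmem, sub_self, abs_zero]
        positivity
      · have h2 : (ε / 2) ^ 2 ≤ ‖h‖ ^ 2 := by gcongr
        refine (hKφ _ hxh j).trans ?_
        rw [div_mul_eq_mul_div, le_div_iff₀ (by positivity)]
        gcongr
    rw [hj, hjg, Real.norm_eq_abs]
    calc |φk j (xk j + h) - φ (xk j) - ⟪gradient φ (xk j), h⟫|
        = |(φ (xk j + h) - φ (xk j) - ⟪gradient φ (xk j), h⟫)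
            + (φk j (xk j + h) - φ (xk j + h))| := by ring_nf
      _ ≤ M * ‖h‖ ^ 2 + K / (ε / 2) ^ 2 * ‖h‖ ^ 2 :=
          (abs_add_le _ _).trans (add_le_add htaylor hdiff)
      _ = (M + K / (ε / 2) ^ 2) * ‖h‖ ^ 2 := by ring
      _ ≤ (M + K / (ε / 2) ^ 2) * (C ^ 2 * ‖z‖ ^ q) := by gcongr
      _ = (M + K / (ε / 2) ^ 2) * C ^ 2 * ‖z‖ ^ q := by ring
  · exact ((integrableOn_norm_rpow hνq).mono_set fun z hz => lt_trans hz hδ).const_mul _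
  · refine ae_of_all _ fun z => ?_
    have hℓlim : Tendsto (fun j => ℓ (xk j) (βk j) z) atTop (𝓝 (ℓ x β z)) :=
      (hℓ.tendsto (x, β, z)).comp (hx.prodMk_nhds (hβ.prodMk_nhds tendsto_const_nhds))
    have h1 := tendsto_apply_of_monotone_or_antitone (fun j => (hφk j).continuous)
      hφ.continuous hmono hlim (hx.add hℓlim)
    have h2 := (hφ.continuous.tendsto x).comp hx
    have h3 := ((hgrad.tendsto x).comp hx).inner (𝕜 := ℝ) hℓlim
    refine ((h1.sub h2).sub h3).congr' ?_
    filter_upwards [hgradk] with j hj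
    simp only [Function.comp_apply, hj.1, hj.2]

/-- for `δ ∈ (0,1)`: (i) for every `φ ∈ C²(ℝᵈ)` the map
`(x,β) ↦ I^{1,δ}_β[x,φ]` is continuous; (ii) if `β_k → β`, `x_k → x`, and `(φ_k) ⊂ C²`
converges monotonically pointwise to `φ ∈ C²` with `φ_k = φ` on a fixed neighbourhood
of `x`, then `I^{1,δ}_{β_k}[x_k,φ_k] → I^{1,δ}_β[x,φ]`. -/
theorem stmt11 {d k : ℕ} (hd : 1 ≤ d) (hk : 1 ≤ k)
    {B : Type*} [MetricSpace B] [CompactSpace B] [Nonempty B]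
    (ν : Measure (Euc k))
    (hν : (∫⁻ z, ENNReal.ofReal (min (‖z‖ ^ 2) 1) ∂ν) ≠ ⊤)
    (ℓ : Euc d → B → Euc k → Euc d)
    (hℓ : Continuous (fun q : Euc d × B × Euc k => ℓ q.1 q.2.1 q.2.2))
    (a b pstar qstar : ℝ) (ha : 0 ≤ a) (hb : 0 ≤ b) (hpstar : 0 < pstar)
    (hab : a * b ≤ pstar) (hqstar : 0 ≤ qstar)
    (hνp : (∫⁻ z in {z : Euc k | 1 ≤ ‖z‖}, ENNReal.ofReal (‖z‖ ^ pstar) ∂ν) ≠ ⊤)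
    (hνq : (∫⁻ z in {z : Euc k | ‖z‖ < 1}, ENNReal.ofReal (‖z‖ ^ qstar) ∂ν) ≠ ⊤)
    (hgrowth : ∀ x : Euc d, ∃ U ∈ 𝓝 x, ∃ C : ℝ, ∀ x' ∈ U, ∀ (β : B) (z : Euc k),
      (1 ≤ ‖z‖ → ‖ℓ x' β z‖ ≤ C * (1 + ‖z‖ ^ a)) ∧
      (‖z‖ < 1 → ‖ℓ x' β z‖ ≤ C * ‖z‖ ^ (qstar / 2)))
    (δ : ℝ) (hδ : δ ∈ Set.Ioo (0:ℝ) 1) :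
    (∀ φ : Euc d → ℝ, ContDiff ℝ 2 φ →
      Continuous (fun q : Euc d × B => I1 ν ℓ δ q.2 q.1 φ)) ∧
    (∀ (βk : ℕ → B) (β : B), Filter.Tendsto βk Filter.atTop (𝓝 β) →
      ∀ (xk : ℕ → Euc d) (x : Euc d), Filter.Tendsto xk Filter.atTop (𝓝 x) →
      ∀ (φ : Euc d → ℝ), ContDiff ℝ 2 φ →
      ∀ (φk : ℕ → Euc d → ℝ), (∀ j, ContDiff ℝ 2 (φk j)) →
      ((∀ y : Euc d, Monotone (fun j => φk j y)) ∨ (∀ y : Euc d, Antitone (fun j => φk j y))) →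
      (∀ y : Euc d, Filter.Tendsto (fun j => φk j y) Filter.atTop (𝓝 (φ y))) →
      (∃ U ∈ 𝓝 x, ∀ j, ∀ y ∈ U, φk j y = φ y) →
      Filter.Tendsto (fun j => I1 ν ℓ δ (βk j) (xk j) (φk j)) Filter.atTop
        (𝓝 (I1 ν ℓ δ β x φ))) := by
  have hg : ∀ x : Euc d, ∃ U ∈ 𝓝 x, ∃ C : ℝ, ∀ x' ∈ U, ∀ (β : B) (z : Euc k),
      ‖z‖ < 1 → ‖ℓ x' β z‖ ≤ C * ‖z‖ ^ (qstar / 2) := fun x => by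
    obtain ⟨U, hU, C, hC⟩ := hgrowth x
    exact ⟨U, hU, C, fun x' hx' β z => (hC x' hx' β z).2⟩
  refine ⟨fun φ hφ => ?_, fun βk β hβ xk x hx φ hφ φk hφk hmono hlim hloc =>
    tendsto_I1 hℓ hqstar hδ.2 hνq (hg x) hβ hx hφ hφk hmono hlim hloc⟩
  refine continuous_iff_seqContinuous.2 fun u p hu => ?_
  exact tendsto_I1 hℓ hqstar hδ.2 hνq (hg p.1) ((continuous_snd.tendsto p).comp hu)
    ((continuous_fst.tendsto p).comp hu) hφ (fun _ => hφ) (Or.inl fun _ => monotone_const)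
    (fun _ => tendsto_const_nhds) ⟨univ, univ_mem, fun _ _ _ => rfl⟩
end
end

section
/- Fix δ ∈ (0,1), x, p ∈ ℝᵈ, r ∈ ℝ and a symmetric d×d matrix X. If u ∈ PB is upper semicontinuous and φ ∈ C²(ℝᵈ), then the map β ↦ −F^β(x, r, p, X, I^{1,δ}_β[x,φ] + I^{2,δ}_β[x,p,u]) is upper semicontinuous on B; in particular, the supremum of this map over the compact set B is attained at some β ∈ B. -/
open Filter Topology Metric Set MeasureTheory Matrix
open scoped RealInnerProductSpace ENNReal

noncomputable section

/-- The Hamiltonian integrand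
`F^β(x,r,p,X,l) = −( (1/2) tr(σ(x,β)σ(x,β)ᵀ X) + ⟨μ(x,β), p⟩ − c(x) r + f(x,β) + l )`. -/
noncomputable def Fb {d dm : ℕ} {B : Type*}
    (σ : Euc d → B → Matrix (Fin d) (Fin dm) ℝ) (μ : Euc d → B → Euc d)
    (f : Euc d → B → ℝ) (c : Euc d → ℝ)
    (β : B) (x : Euc d) (r : ℝ) (p : Euc d) (X : Matrix (Fin d) (Fin d) ℝ) (l : ℝ) : ℝ :=
  -((1/2) * Matrix.trace (σ x β * (σ x β)ᵀ * X) + ⟪μ x β, p⟫ - c x * r + f x β + l)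

theorem lowerSemicontinuous_lintegral {α B : Type*} [MeasurableSpace α] {m : Measure α}
    [TopologicalSpace B] [FirstCountableTopology B] {F : B → α → ℝ≥0∞}
    (hF : ∀ β, AEMeasurable (F β) m)
    (hlsc : ∀ᵐ z ∂m, LowerSemicontinuous fun β => F β z) :
    LowerSemicontinuous fun β => ∫⁻ z, F β z ∂m := by
  rw [lowerSemicontinuous_iff_le_liminf]
  intro β
  refine le_trans (lintegral_mono_ae ?_) (lintegral_liminf_le' hF)
  filter_upwards [hlsc] with z hz using hz.le_liminf β

theorem upperSemicontinuous_integral_of_dominated {α B : Type*} [MeasurableSpace α]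
    {m : Measure α} [TopologicalSpace B] [FirstCountableTopology B] {F : B → α → ℝ} {G : α → ℝ}
    (hF : ∀ β, AEStronglyMeasurable (F β) m) (hFG : ∀ β, ∀ᵐ z ∂m, ‖F β z‖ ≤ G z)
    (hG : Integrable G m) (husc : ∀ᵐ z ∂m, UpperSemicontinuous fun β => F β z) :
    UpperSemicontinuous fun β => ∫ z, F β z ∂m := by
  have hint : ∀ β, Integrable (F β) m := fun β => hG.mono' (hF β) (hFG β)
  have hle : ∀ β, F β ≤ᵐ[m] G := fun β => by
    filter_upwards [hFG β] with z hz using (Real.le_norm_self _).trans hz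
  have hlsc : LowerSemicontinuous fun β => ∫⁻ z, ENNReal.ofReal (G z - F β z) ∂m := by
    refine lowerSemicontinuous_lintegral
      (fun β => (hG.sub (hint β)).aestronglyMeasurable.aemeasurable.ennreal_ofReal) ?_
    filter_upwards [husc] with z hz
    have hanti : Antitone fun t : ℝ => ENNReal.ofReal (G z - t) := fun s t hst =>
      ENNReal.ofReal_le_ofReal (by linarith)
    have hcont : Continuous fun t : ℝ => ENNReal.ofReal (G z - t) :=
      ENNReal.continuous_ofReal.comp (by fun_prop)
    exact hcont.comp_upperSemicontinuous_antitone hz hanti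
  have heq : ∀ β, ∫⁻ z, ENNReal.ofReal (G z - F β z) ∂m
      = ENNReal.ofReal (∫ z, G z ∂m - ∫ z, F β z ∂m) := fun β => by
    rw [← integral_sub hG (hint β)]
    refine (ofReal_integral_eq_lintegral_ofReal (hG.sub (hint β)) ?_).symm
    filter_upwards [hle β] with z hz using sub_nonneg.2 hz
  simp only [heq] at hlsc
  intro β₀ y hy
  rcases lt_or_ge (∫ z, G z ∂m) y with h | h
  · exact Eventually.of_forall fun β => (integral_mono_ae (hint β) hG (hle β)).trans_lt h
  · have hy' : ENNReal.ofReal (∫ z, G z ∂m - y)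
        < ENNReal.ofReal (∫ z, G z ∂m - ∫ z, F β₀ z ∂m) :=
      (ENNReal.ofReal_lt_ofReal_iff_of_nonneg (sub_nonneg.2 h)).2 (by linarith)
    filter_upwards [hlsc β₀ _ hy'] with β hβ
    have := (ENNReal.ofReal_lt_ofReal_iff_of_nonneg (sub_nonneg.2 h)).1 hβ
    linarith

theorem ContDiff.exists_abs_sub_gradient_le {E : Type*} [NormedAddCommGroup E]
    [InnerProductSpace ℝ E] [FiniteDimensional ℝ E] {φ : E → ℝ} (hφ : ContDiff ℝ 2 φ)
    (x : E) (R : ℝ) :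
    ∃ K : ℝ, 0 ≤ K ∧ ∀ h : E, ‖h‖ ≤ R →
      |φ (x + h) - φ x - ⟪gradient φ x, h⟫| ≤ K * ‖h‖ ^ 2 := by
  have hd : ContDiff ℝ 1 (fderiv ℝ φ) := hφ.fderiv_right (by norm_num)
  obtain ⟨K, hK⟩ := (hd.locallyLipschitz.locallyLipschitzOn
    (s := closedBall x R)).exists_lipschitzOnWith_of_compact (isCompact_closedBall x R)
  refine ⟨K, K.2, fun h hh => ?_⟩
  have hx : x ∈ closedBall x ‖h‖ := mem_closedBall_self (norm_nonneg h)
  have hy : x + h ∈ closedBall x ‖h‖ := by simp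
  have hsub : closedBall x ‖h‖ ⊆ closedBall x R := closedBall_subset_closedBall hh
  have := (convex_closedBall x ‖h‖).norm_image_sub_le_of_norm_hasFDerivWithin_le'
    (f := φ) (f' := fderiv ℝ φ) (φ := fderiv ℝ φ x) (C := K * ‖h‖)
    (fun y _ => ((hφ.differentiable (by norm_num)) y).hasFDerivAt.hasFDerivWithinAt)
    (fun y hy => (hK.norm_sub_le (hsub hy) (hsub hx)).trans
      (mul_le_mul_of_nonneg_left (by simpa [dist_eq_norm] using hy) K.2)) hx hy
  rw [add_sub_cancel_left, ← toDual_gradient, InnerProductSpace.toDual_apply_apply] at this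
  rw [pow_two, ← mul_assoc]
  exact this

theorem continuous_I1 {d k : ℕ} {B : Type*} [TopologicalSpace B] [FirstCountableTopology B]
    {ν : Measure (Euc k)} {ℓ : Euc d → B → Euc k → Euc d} {x : Euc d}
    (hℓ : Continuous fun w : B × Euc k => ℓ x w.1 w.2) {q : ℝ} (hq : 0 ≤ q)
    (hνq : (∫⁻ z in {z : Euc k | ‖z‖ < 1}, ENNReal.ofReal (‖z‖ ^ q) ∂ν) ≠ ⊤)
    {C : ℝ} (hC : ∀ (β : B) (z : Euc k), ‖z‖ < 1 → ‖ℓ x β z‖ ≤ C * ‖z‖ ^ (q / 2))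
    {δ : ℝ} (hδ : δ ≤ 1) {φ : Euc d → ℝ} (hφ : ContDiff ℝ 2 φ) :
    Continuous fun β : B => I1 ν ℓ δ β x φ := by
  have hφc : Continuous φ := hφ.continuous
  have hℓβ : ∀ β, Continuous (ℓ x β) := fun β => hℓ.comp (by fun_prop : Continuous fun z => (β, z))
  have hℓz : ∀ z, Continuous fun β => ℓ x β z := fun z =>
    hℓ.comp (by fun_prop : Continuous fun β => (β, z))
  obtain ⟨K, hK0, hK⟩ := hφ.exists_abs_sub_gradient_le x |C|
  have hpow : Continuous fun z : Euc k => ‖z‖ ^ q := continuous_norm.rpow_const fun _ => .inr hq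
  have hint : Integrable (fun z : Euc k => ‖z‖ ^ q) (ν.restrict {z | ‖z‖ < 1}) :=
    ⟨hpow.aestronglyMeasurable, (hasFiniteIntegral_iff_ofReal
      (.of_forall fun z => by positivity)).2 hνq.lt_top⟩
  have hint' : Integrable (fun z : Euc k => K * C ^ 2 * ‖z‖ ^ q) (ν.restrict {z | ‖z‖ < δ}) :=
    (hint.mono_measure (Measure.restrict_mono
      (fun z (hz : ‖z‖ < δ) => hz.trans_le hδ) le_rfl)).const_mul _
  refine continuous_of_dominated (fun β => ?_) (fun β => ?_) hint' (.of_forall fun z => ?_)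
  · have := hℓβ β
    exact Continuous.aestronglyMeasurable (by fun_prop)
  · refine (ae_restrict_iff' (measurableSet_lt measurable_norm measurable_const)).2
      (.of_forall fun z (hz : ‖z‖ < δ) => ?_)
    have hz1 : ‖z‖ < 1 := hz.trans_le hδ
    have hzq : ‖z‖ ^ (q / 2) ≤ 1 := Real.rpow_le_one (norm_nonneg z) hz1.le (by positivity)
    have hℓC := hC β z hz1
    have hle : ‖ℓ x β z‖ ≤ |C| := calc
      ‖ℓ x β z‖ ≤ |C| * ‖z‖ ^ (q / 2) := hℓC.trans (by gcongr; exact le_abs_self C)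
      _ ≤ |C| := mul_le_of_le_one_right (abs_nonneg C) hzq
    calc _ ≤ K * ‖ℓ x β z‖ ^ 2 := hK _ hle
      _ ≤ K * (C * ‖z‖ ^ (q / 2)) ^ 2 := by gcongr
      _ = K * C ^ 2 * ‖z‖ ^ q := by
        rw [mul_pow, ← Real.rpow_natCast (‖z‖ ^ (q / 2)), ← Real.rpow_mul (norm_nonneg z)]
        norm_num
        ring
  · have := hℓz z
    fun_prop

theorem norm_add_rpow_le {d k : ℕ} {x h : Euc d} {z : Euc k} {a b p C s : ℝ} (ha : 0 ≤ a)
    (hb : 0 ≤ b) (hab : a * b ≤ p) (hC0 : 0 ≤ C) (hs : 0 ≤ s)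
    (hlarge : 1 ≤ ‖z‖ → ‖h‖ ≤ C * (1 + ‖z‖ ^ a)) (hsmall : ‖z‖ < 1 → ‖h‖ ≤ C * ‖z‖ ^ s) :
    ‖x + h‖ ^ b
      ≤ (‖x‖ + 2 * C) ^ b * (1 + {z : Euc k | 1 ≤ ‖z‖}.indicator (fun z => ‖z‖ ^ p) z) := by
  rcases le_or_gt 1 ‖z‖ with hz | hz
  · have hza : 1 ≤ ‖z‖ ^ a := Real.one_le_rpow hz ha
    have hle : ‖x + h‖ ≤ (‖x‖ + 2 * C) * ‖z‖ ^ a := by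
      have h1 := norm_add_le x h
      have h2 := hlarge hz
      nlinarith [norm_nonneg x]
    rw [indicator_of_mem (show z ∈ {z : Euc k | 1 ≤ ‖z‖} from hz)]
    calc ‖x + h‖ ^ b ≤ ((‖x‖ + 2 * C) * ‖z‖ ^ a) ^ b := by gcongr
      _ = (‖x‖ + 2 * C) ^ b * ‖z‖ ^ (a * b) := by
        rw [Real.mul_rpow (by positivity) (by positivity), Real.rpow_mul (norm_nonneg z)]
      _ ≤ (‖x‖ + 2 * C) ^ b * ‖z‖ ^ p := by gcongr
      _ ≤ _ := by gcongr; linarith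
  · have hzs : ‖z‖ ^ s ≤ 1 := Real.rpow_le_one (norm_nonneg z) hz.le hs
    have hle : ‖x + h‖ ≤ ‖x‖ + 2 * C := by
      have h1 := norm_add_le x h
      have h2 := hsmall hz
      nlinarith
    rw [indicator_of_notMem (show z ∉ {z : Euc k | 1 ≤ ‖z‖} from not_le.2 hz), add_zero, mul_one]
    gcongr

theorem upperSemicontinuous_I2 {d k : ℕ} {B : Type*} [TopologicalSpace B]
    [FirstCountableTopology B] {ν : Measure (Euc k)}
    (hν : (∫⁻ z, ENNReal.ofReal (min (‖z‖ ^ 2) 1) ∂ν) ≠ ⊤)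
    {ℓ : Euc d → B → Euc k → Euc d} {x : Euc d}
    (hℓ : Continuous fun w : B × Euc k => ℓ x w.1 w.2) {a b pstar s : ℝ} (ha : 0 ≤ a)
    (hb : 0 ≤ b) (hpstar : 0 ≤ pstar) (hab : a * b ≤ pstar) (hs : 0 ≤ s)
    (hνp : (∫⁻ z in {z : Euc k | 1 ≤ ‖z‖}, ENNReal.ofReal (‖z‖ ^ pstar) ∂ν) ≠ ⊤)
    {C : ℝ} (hC0 : 0 ≤ C)
    (hlarge : ∀ (β : B) (z : Euc k), 1 ≤ ‖z‖ → ‖ℓ x β z‖ ≤ C * (1 + ‖z‖ ^ a))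
    (hsmall : ∀ (β : B) (z : Euc k), ‖z‖ < 1 → ‖ℓ x β z‖ ≤ C * ‖z‖ ^ s)
    {δ : ℝ} (hδ : 0 < δ) (p : Euc d) {u : Euc d → ℝ} (hu : PB b u)
    (husc : UpperSemicontinuous u) :
    UpperSemicontinuous fun β : B => I2 ν ℓ δ β x p u := by
  obtain ⟨hum, Cu, hCu⟩ := hu
  have hℓβ : ∀ β, Continuous (ℓ x β) := fun β => hℓ.comp (by fun_prop : Continuous fun z => (β, z))
  have hℓz : ∀ z, Continuous fun β => ℓ x β z := fun z =>
    hℓ.comp (by fun_prop : Continuous fun β => (β, z))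
  have hfin : ν {z : Euc k | δ ≤ ‖z‖} < ⊤ := by
    have hint : Integrable (fun z : Euc k => min (‖z‖ ^ 2) 1) ν :=
      ⟨Continuous.aestronglyMeasurable (by fun_prop), (hasFiniteIntegral_iff_ofReal
        (.of_forall fun z => by positivity)).2 hν.lt_top⟩
    refine (measure_mono fun z (hz : δ ≤ ‖z‖) => ?_).trans_lt
      (hint.measure_ge_lt_top (show 0 < min (δ ^ 2) 1 by positivity))
    exact min_le_min_right 1 (pow_le_pow_left₀ hδ.le hz 2)
  have : IsFiniteMeasure (ν.restrict {z : Euc k | δ ≤ ‖z‖}) := ⟨by simpa using hfin⟩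
  have hmeas1 : MeasurableSet {z : Euc k | 1 ≤ ‖z‖} :=
    measurableSet_le measurable_const measurable_norm
  have hpow : Continuous fun z : Euc k => ‖z‖ ^ pstar :=
    continuous_norm.rpow_const fun _ => .inr hpstar
  have hind : Integrable ({z : Euc k | 1 ≤ ‖z‖}.indicator fun z => ‖z‖ ^ pstar) ν :=
    (integrable_indicator_iff hmeas1).2 ⟨hpow.aestronglyMeasurable,
      (hasFiniteIntegral_iff_ofReal (.of_forall fun z => by positivity)).2 hνp.lt_top⟩
  have hG : Integrable (fun z => |Cu| * (1 + (‖x‖ + 2 * C) ^ b *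
      (1 + {z : Euc k | 1 ≤ ‖z‖}.indicator (fun z => ‖z‖ ^ pstar) z)) + |u x| + ‖p‖ * C)
      (ν.restrict {z : Euc k | δ ≤ ‖z‖}) :=
    (((((integrable_const 1).add (((integrable_const 1).add hind.restrict).const_mul _)).const_mul
      _).add (integrable_const _)).add (integrable_const _))
  refine upperSemicontinuous_integral_of_dominated (fun β => ?_) (fun β => .of_forall fun z => ?_)
    hG (.of_forall fun z => ?_)
  · have := hℓβ β
    refine Measurable.aestronglyMeasurable ?_
    refine ((hum.comp (by fun_prop)).sub measurable_const).sub
      (Measurable.ite (measurableSet_lt measurable_norm measurable_const) ?_ measurable_const)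
    exact Continuous.measurable (by fun_prop)
  · have h1 : |u (x + ℓ x β z)| ≤ |Cu| * (1 + (‖x‖ + 2 * C) ^ b *
        (1 + {z : Euc k | 1 ≤ ‖z‖}.indicator (fun z => ‖z‖ ^ pstar) z)) :=
      calc |u (x + ℓ x β z)| ≤ Cu * (1 + ‖x + ℓ x β z‖ ^ b) := hCu _
        _ ≤ |Cu| * (1 + ‖x + ℓ x β z‖ ^ b) := by gcongr; exact le_abs_self Cu
        _ ≤ _ := by
          gcongr
          exact norm_add_rpow_le ha hb hab hC0 hs (hlarge β z) (hsmall β z)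
    have h2 : |if ‖z‖ < 1 then ⟪p, ℓ x β z⟫ else 0| ≤ ‖p‖ * C := by
      split_ifs with hz
      · have hzs : ‖z‖ ^ s ≤ 1 := Real.rpow_le_one (norm_nonneg z) hz.le hs
        refine (abs_real_inner_le_norm _ _).trans ?_
        gcongr
        exact (hsmall β z hz).trans (mul_le_of_le_one_right hC0 hzs)
      · rw [abs_zero]
        positivity
    rw [Real.norm_eq_abs]
    have h3 := abs_sub (u (x + ℓ x β z) - u x) (if ‖z‖ < 1 then ⟪p, ℓ x β z⟫ else 0)
    have h4 := abs_sub (u (x + ℓ x β z)) (u x)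
    linarith
  · have hz := hℓz z
    have hcont : Continuous fun β => -u x - (if ‖z‖ < 1 then ⟪p, ℓ x β z⟫ else 0) := by
      split_ifs <;> fun_prop
    have hcomp : UpperSemicontinuous fun β => u (x + ℓ x β z) :=
      husc.comp (by fun_prop : Continuous fun β => x + ℓ x β z)
    simpa only [sub_eq_add_neg, add_assoc] using hcomp.add hcont.upperSemicontinuous

/-- for `δ ∈ (0,1)`, fixed `x, p ∈ ℝᵈ`, `r ∈ ℝ`, a symmetric matrix `X`,
`u ∈ PB` upper semicontinuous and `φ ∈ C²(ℝᵈ)`, the map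
`β ↦ −F^β(x,r,p,X, I^{1,δ}_β[x,φ] + I^{2,δ}_β[x,p,u])` is upper semicontinuous on `B`;
in particular its supremum over the compact set `B` is attained. -/
theorem stmt12 {d k dm : ℕ} (hd : 1 ≤ d) (hk : 1 ≤ k)
    {B : Type*} [MetricSpace B] [CompactSpace B] [Nonempty B]
    (ν : Measure (Euc k))
    (hν : (∫⁻ z, ENNReal.ofReal (min (‖z‖ ^ 2) 1) ∂ν) ≠ ⊤)
    (ℓ : Euc d → B → Euc k → Euc d)
    (hℓ : Continuous (fun q : Euc d × B × Euc k => ℓ q.1 q.2.1 q.2.2))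
    (a b pstar qstar : ℝ) (ha : 0 ≤ a) (hb : 0 ≤ b) (hpstar : 0 < pstar)
    (hab : a * b ≤ pstar) (hqstar : 0 ≤ qstar)
    (hνp : (∫⁻ z in {z : Euc k | 1 ≤ ‖z‖}, ENNReal.ofReal (‖z‖ ^ pstar) ∂ν) ≠ ⊤)
    (hνq : (∫⁻ z in {z : Euc k | ‖z‖ < 1}, ENNReal.ofReal (‖z‖ ^ qstar) ∂ν) ≠ ⊤)
    (hgrowth : ∀ x : Euc d, ∃ U ∈ 𝓝 x, ∃ C : ℝ, ∀ x' ∈ U, ∀ (β : B) (z : Euc k),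
      (1 ≤ ‖z‖ → ‖ℓ x' β z‖ ≤ C * (1 + ‖z‖ ^ a)) ∧
      (‖z‖ < 1 → ‖ℓ x' β z‖ ≤ C * ‖z‖ ^ (qstar / 2)))
    (σ : Euc d → B → Matrix (Fin d) (Fin dm) ℝ)
    (hσ : Continuous (fun q : Euc d × B => σ q.1 q.2))
    (μ : Euc d → B → Euc d) (hμ : Continuous (fun q : Euc d × B => μ q.1 q.2))
    (f : Euc d → B → ℝ) (hf : Continuous (fun q : Euc d × B => f q.1 q.2))
    (c : Euc d → ℝ) (hc : Continuous c)
    (δ : ℝ) (hδ : δ ∈ Set.Ioo (0:ℝ) 1)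
    (x p : Euc d) (r : ℝ) (X : Matrix (Fin d) (Fin d) ℝ) (hX : X.IsSymm)
    (u : Euc d → ℝ) (hu : PB b u) (husc : UpperSemicontinuous u)
    (φ : Euc d → ℝ) (hφ : ContDiff ℝ 2 φ) :
    UpperSemicontinuous
        (fun β : B => -(Fb σ μ f c β x r p X (I1 ν ℓ δ β x φ + I2 ν ℓ δ β x p u))) ∧
      ∃ β0 : B, ∀ β : B,
        -(Fb σ μ f c β x r p X (I1 ν ℓ δ β x φ + I2 ν ℓ δ β x p u)) ≤
          -(Fb σ μ f c β0 x r p X (I1 ν ℓ δ β0 x φ + I2 ν ℓ δ β0 x p u)) := by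
  obtain ⟨U, hU, C, hC⟩ := hgrowth x
  replace hC := hC x (mem_of_mem_nhds hU)
  have hlarge : ∀ (β : B) (z : Euc k), 1 ≤ ‖z‖ → ‖ℓ x β z‖ ≤ |C| * (1 + ‖z‖ ^ a) :=
    fun β z hz => ((hC β z).1 hz).trans (by gcongr; exact le_abs_self C)
  have hsmall : ∀ (β : B) (z : Euc k), ‖z‖ < 1 → ‖ℓ x β z‖ ≤ |C| * ‖z‖ ^ (qstar / 2) :=
    fun β z hz => ((hC β z).2 hz).trans (by gcongr; exact le_abs_self C)
  have hℓx : Continuous fun w : B × Euc k => ℓ x w.1 w.2 :=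
    hℓ.comp (by fun_prop : Continuous fun w : B × Euc k => (x, w.1, w.2))
  have hx : Continuous fun β : B => (x, β) := by fun_prop
  have hσx : Continuous fun β => σ x β := hσ.comp hx
  have hμx : Continuous fun β => μ x β := hμ.comp hx
  have hfx : Continuous fun β => f x β := hf.comp hx
  have hI1 := continuous_I1 hℓx hqstar hνq hsmall hδ.2.le hφ
  have hI2 := upperSemicontinuous_I2 hν hℓx ha hb hpstar.le hab (by positivity) hνp
    (abs_nonneg C) hlarge hsmall hδ.1 p hu husc
  have hcont : Continuous fun β => (1 / 2) * Matrix.trace (σ x β * (σ x β)ᵀ * X) + ⟪μ x β, p⟫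
      - c x * r + f x β + I1 ν ℓ δ β x φ := by
    have htr : Continuous fun β => Matrix.trace (σ x β * (σ x β)ᵀ * X) :=
      ((hσx.matrix_mul hσx.matrix_transpose).matrix_mul continuous_const).matrix_trace
    fun_prop
  have husc' : UpperSemicontinuous
      fun β => -(Fb σ μ f c β x r p X (I1 ν ℓ δ β x φ + I2 ν ℓ δ β x p u)) := by
    simpa only [Fb, neg_neg, add_assoc] using hcont.upperSemicontinuous.add hI2
  refine ⟨husc', ?_⟩
  obtain ⟨β₀, -, hβ₀⟩ := (husc'.upperSemicontinuousOn univ).exists_isMaxOn univ_nonempty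
    isCompact_univ
  exact ⟨β₀, fun β => hβ₀ (mem_univ β)⟩
end
end
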